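/- Let N be a PO system, J an ideal of N, and {U_n | n ∈ N}* a trim N-partition of the ω-Stone space W. Then {w ∈ W | I_w = J} equals the closure of U_J minus the union over all ideals K of N with K ⊊ J of the closures of U_K, where U_J = ⋃_{n ∈ J} U_n. Equivalently, for any w ∈ W and any ideal K of N, w lies in the closure of U_K if and only if I_w ⊆ K. -/

import Mathlib

open Set Filter Topology

universe u v

/-- A PO system: a set with a transitive antisymmetric relation `<`. -/
structure POSystem (P : Type u) : Type u where
  lt : P → P → Prop
  lt_trans : ∀ {a b c}, lt a b → lt b c → lt a c
  lt_antisymm : ∀ {a b}, lt a b → lt b a → a = b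

namespace POSystem

variable {P : Type*} {Q : Type*}

/-- `a ≤ b` iff `a < b` or `a = b`. -/
def le (S : POSystem P) (a b : P) : Prop := S.lt a b ∨ a = b

theorem le_trans {S : POSystem P} {a b c : P} (h1 : S.le a b) (h2 : S.le b c) :
    S.le a c := by
  rcases h1 with h1 | rfl
  · rcases h2 with h2 | rfl
    · exact Or.inl (S.lt_trans h1 h2)
    · exact Or.inl h1
  · exact h2

/-- A morphism of PO systems. -/
def IsMorphism (SQ : POSystem Q) (SP : POSystem P) (α : Q → P) : Prop :=
  ∀ q : Q, α '' {r | SQ.lt q r} = {p | SP.lt (α q) p}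

/-- An isomorphism of PO systems. -/
def IsIso (SQ : POSystem Q) (SP : POSystem P) (β : Q → P) : Prop :=
  Function.Bijective β ∧ ∀ a b : Q, SQ.lt a b ↔ SP.lt (β a) (β b)

/-- An ideal of a PO system: a nonempty directed lower subset. -/
def IsIdeal (S : POSystem P) (J : Set P) : Prop :=
  J.Nonempty ∧ (∀ x ∈ J, ∀ y : P, S.le y x → y ∈ J) ∧
    ∀ x ∈ J, ∀ y ∈ J, ∃ z ∈ J, S.le x z ∧ S.le y z

/-- An ideal of a subset `Qs` of a PO system. -/
def IsIdealOf (S : POSystem P) (Qs : Set P) (J : Set P) : Prop :=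
  J.Nonempty ∧ J ⊆ Qs ∧ (∀ x ∈ J, ∀ y ∈ Qs, S.le y x → y ∈ J) ∧
    ∀ x ∈ J, ∀ y ∈ J, ∃ z ∈ J, S.le x z ∧ S.le y z

/-- The principal ideal `p↓`. -/
def principalIdeal (S : POSystem P) (p : P) : Set P := {q | S.le q p}

theorem principal_isIdeal (S : POSystem P) (p : P) : IsIdeal S (principalIdeal S p) :=
  ⟨⟨p, Or.inr rfl⟩, fun _ hx y hy => le_trans hy hx,
    fun _ hx _ hy => ⟨p, Or.inr rfl, hx, hy⟩⟩

/-- `p` is the supremum of the subset `A`. -/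
def IsSupOf (S : POSystem P) (p : P) (A : Set P) : Prop :=
  (∀ a ∈ A, S.le a p) ∧ ∀ q : P, (∀ a ∈ A, S.le a q) → S.le p q

/-- `p` is separated in `P` if it is not the supremum of a strictly increasing sequence. -/
def Separated (S : POSystem P) (p : P) : Prop :=
  ¬ ∃ u : ℕ → P, (∀ n, S.lt (u n) (u (n + 1)) ∧ u n ≠ u (n + 1)) ∧
      IsSupOf S p (Set.range u)

/-- `p` is compact in `P`. -/
def CompactIn (S : POSystem P) (p : P) : Prop :=
  ∀ J : Set P, IsIdeal S J → ∀ s : P, IsSupOf S s J → S.le p s → p ∈ J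

/-- The lower closure `N↓` of a subset. -/
def downSet (S : POSystem P) (N : Set P) : Set P := {p | ∃ q ∈ N, S.le p q}

/-- `N` has a finite foundation. -/
def HasFinFoundation (S : POSystem P) (N : Set P) : Prop :=
  ∃ F : Set P, F.Finite ∧ F ⊆ downSet S N ∧ ∀ r ∈ downSet S N, ∃ p ∈ F, S.le p r

def PDelta (S : POSystem P) : Set P := {p | HasFinFoundation S {p}}

def IsLowerSubset (S : POSystem P) (L : Set P) : Prop :=
  ∀ p ∈ L, ∀ q : P, S.le q p → q ∈ L

/-- Minimal elements of `L`. -/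
def minIn (S : POSystem P) (L : Set P) : Set P :=
  {p | p ∈ L ∧ ∀ q ∈ L, S.le q p → q = p}

/-- `L_min^d`: minimal elements of `L` lying in `P^d`. -/
def LminD (S : POSystem P) (L : Set P) : Set P := {p | p ∈ minIn S L ∧ ¬ S.lt p p}

/-- `(P, L, f)` is an extended PO system. -/
def IsExtPO (S : POSystem P) (L : Set P) (f : P → ℕ) : Prop :=
  IsLowerSubset S L ∧ L ⊆ PDelta S ∧ ∀ p ∈ LminD S L, 0 < f p

/-- The order relation on the ideal completion `id(P)`: ordered by inclusion, with
`id(P)^d` the principal ideals `p↓` for `p ∈ P^d`. -/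
def idLt (S : POSystem P) (J K : {J : Set P // IsIdeal S J}) : Prop :=
  (J.1 ⊆ K.1 ∧ J ≠ K) ∨ (J = K ∧ ¬ ∃ p : P, ¬ S.lt p p ∧ J.1 = principalIdeal S p)

/-- The ideal completion `id(P)` of a PO system. -/
def idPO (S : POSystem P) : POSystem {J : Set P // IsIdeal S J} where
  lt := idLt S
  lt_trans := by
    intro a b c h1 h2
    unfold idLt at h1 h2 ⊢
    rcases h1 with ⟨hab, hne⟩ | ⟨heq, h⟩
    · rcases h2 with ⟨hbc, hne'⟩ | ⟨heq', h'⟩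
      · refine Or.inl ⟨hab.trans hbc, fun hac => hne ?_⟩
        exact Subtype.ext (subset_antisymm hab (by rw [hac]; exact hbc))
      · rw [← heq']; exact Or.inl ⟨hab, hne⟩
    · rw [heq]; exact h2
  lt_antisymm := by
    intro a b h1 h2
    unfold idLt at h1 h2
    rcases h1 with ⟨hab, _⟩ | ⟨heq, _⟩
    · rcases h2 with ⟨hba, _⟩ | ⟨heq, _⟩
      · exact Subtype.ext (subset_antisymm hab hba)
      · exact heq.symm
    · exact heq

/-- The restriction of a PO system to a subset. -/
def restrictPO (S : POSystem P) (T : Set P) : POSystem T where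
  lt a b := S.lt a b
  lt_trans := fun h1 h2 => S.lt_trans h1 h2
  lt_antisymm := fun h1 h2 => Subtype.ext (S.lt_antisymm h1 h2)

end POSystem

open POSystem

section Partitions

variable {W : Type*} [TopologicalSpace W] {P : Type*} {Q : Type*}

/-- The derived set (set of limit points) of `A`. -/
def limitPts (A : Set W) : Set W := {x | x ∈ closure (A \ {x})}

/-- The type `T(A)` of a subset `A` with respect to a partition `X`. -/
def ptype (X : P → Set W) (A : Set W) : Set P := {p | (A ∩ X p).Nonempty}

/-- A `P`-partition of `W`: pairwise disjoint nonempty sets `X p` such that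
`(X p)' ∩ X = ⋃_{q < p} X q`. -/
def IsPPartition (S : POSystem P) (X : P → Set W) : Prop :=
  (∀ p, (X p).Nonempty) ∧ (Pairwise fun p q => Disjoint (X p) (X q)) ∧
    ∀ p, limitPts (X p) ∩ (⋃ q, X q) = ⋃ q ∈ {q : P | S.lt q p}, X q

/-- `A` is a `p`-trim set. -/
def IsTrimAt (S : POSystem P) (X : P → Set W) (A : Set W) (p : P) : Prop :=
  IsCompact A ∧ IsOpen A ∧ ptype X A = {q | S.le p q} ∧
    (¬ S.lt p p → ∃! x, x ∈ A ∩ X p)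

/-- `A` is a trim set. -/
def IsTrimSet (S : POSystem P) (X : P → Set W) (A : Set W) : Prop :=
  ∃ p, IsTrimAt S X A p

/-- `P̂`: the set of `p` for which some `p`-trim set exists. -/
def Phat (S : POSystem P) (X : P → Set W) : Set P := {p | ∃ A, IsTrimAt S X A p}

/-- Axiom T1: every point has a neighbourhood base of trim sets. -/
def HasTrimBases (S : POSystem P) (X : P → Set W) : Prop :=
  ∀ w : W, ∀ U ∈ nhds w, ∃ A, IsTrimSet S X A ∧ w ∈ A ∧ A ⊆ U

/-- Axiom T2 (fullness). -/
def IsFull (S : POSystem P) (X : P → Set W) : Prop :=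
  ∀ p ∈ Phat S X, ∀ w : W,
    (∀ U ∈ nhds w, ∃ A, IsTrimAt S X A p ∧ w ∈ A ∧ A ⊆ U) → w ∈ X p

/-- `w` is a clean point. -/
def IsCleanPt (S : POSystem P) (X : P → Set W) (w : W) : Prop :=
  ∃ p, w ∈ X p ∧ ∃ A, IsTrimAt S X A p ∧ w ∈ A

/-- Axiom T3: all points of `X` are clean. -/
def AllClean (S : POSystem P) (X : P → Set W) : Prop :=
  ∀ p : P, ∀ w ∈ X p, ∃ A, IsTrimAt S X A p ∧ w ∈ A

/-- A trim `P`-partition. -/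
def IsTrimPartition (S : POSystem P) (X : P → Set W) : Prop :=
  IsPPartition S X ∧ HasTrimBases S X ∧ IsFull S X ∧ AllClean S X

/-- A complete partition: the blocks cover `W`. -/
def IsCompletePartition (X : P → Set W) : Prop := (⋃ p, X p) = Set.univ

/-- `Y` refines `Z` via `α`. -/
def Refines (Y : Q → Set W) (Z : P → Set W) (α : Q → P) : Prop :=
  ∀ q, Y q ⊆ Z (α q)

/-- `Y` regularly refines `Z` via `α` (`Z` regularly consolidates `Y` via `α`). -/
def RegRefines (SQ : POSystem Q) (SP : POSystem P) (Y : Q → Set W) (Z : P → Set W)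
    (α : Q → P) : Prop :=
  Refines Y Z α ∧ ∀ p ∈ Phat SP Z, ∀ A : Set W, IsTrimAt SP Z A p → p ∈ α '' ptype Y A

/-- A semi-trim partition: T1, T2, and clean points are dense in each `X p`, `p ∈ P̂`. -/
def IsSemiTrim (S : POSystem P) (X : P → Set W) : Prop :=
  IsPPartition S X ∧ HasTrimBases S X ∧ IsFull S X ∧
    ∀ p ∈ Phat S X, X p ⊆ closure {w | w ∈ X p ∧ ∃ A, IsTrimAt S X A p ∧ w ∈ A}

/-- A strongly semi-trim partition: T1, T2, and all points of `X p` are clean, `p ∈ P̂`. -/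
def IsStronglySemiTrim (S : POSystem P) (X : P → Set W) : Prop :=
  IsPPartition S X ∧ HasTrimBases S X ∧ IsFull S X ∧
    ∀ p ∈ Phat S X, ∀ w ∈ X p, ∃ A, IsTrimAt S X A p ∧ w ∈ A

/-- The labels of a sequence are pairwise strictly incomparable or strictly increasing. -/
def PairwiseIncompOrStrictIncr (S : POSystem P) (τ : ℕ → P) : Prop :=
  (∀ j k, j ≠ k → ¬ S.le (τ j) (τ k)) ∨ (∀ j k, j < k → S.lt (τ j) (τ k) ∧ τ j ≠ τ k)

/-- A rank `P`-partition: a complete `P`-partition satisfying RP1 and RP2. -/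
def IsRankPartition (S : POSystem P) (X : P → Set W) : Prop :=
  IsPPartition S X ∧ IsCompletePartition X ∧
    (∀ q : P, Separated S q → ∀ (x : W) (u : ℕ → W) (τx : P) (τu : ℕ → P),
      x ∈ X τx → (∀ k, u k ∈ X (τu k)) →
      Filter.Tendsto u Filter.atTop (nhds x) → (∀ k, u k ≠ x) →
      S.le q τx → PairwiseIncompOrStrictIncr S τu →
      ∀ᶠ k in Filter.atTop, S.le q (τu k)) ∧
    (∀ (x : W) (τx : P), x ∈ X τx → ¬ Separated S τx →
      ∃ u : ℕ → W, Filter.Tendsto u Filter.atTop (nhds x) ∧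
        ∀ k, ∃ q, u k ∈ X q ∧ S.lt q τx ∧ q ≠ τx)

/-- `I_w`: the set of types of trim neighbourhoods of `w`. -/
def Iw (S : POSystem P) (X : P → Set W) (w : W) : Set P :=
  {p | ∃ A : Set W, IsTrimAt S X A p ∧ w ∈ A}

/-- A trim `(P, L, f)`-partition. -/
def IsTrimPLF (S : POSystem P) (L : Set P) (f : P → ℕ) (Z : P → Set W) : Prop :=
  IsTrimPartition S Z ∧ (∀ p, IsCompact (closure (Z p)) ↔ p ∈ L) ∧
    ∀ p ∈ LminD S L, Nat.card (Z p) = f p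

/-- A bounded trim `(P, L, f)`-partition. -/
def IsBoundedTrimPLF (S : POSystem P) (L : Set P) (f : P → ℕ) (Z : P → Set W) : Prop :=
  IsTrimPLF S L f Z ∧ IsCompact (closure (⋃ p ∈ L, Z p))

end Partitions

section Primitive

variable {W : Type*} [TopologicalSpace W]

/-- The ideal `(A)` of compact open subsets of `A`. -/
def coIdeal (A : Set W) : Set (Set W) := {C | IsCompact C ∧ IsOpen C ∧ C ⊆ A}

/-- `(A) ≅ (B)` as Boolean rings (equivalently, as posets). -/
def IdealIso (A B : Set W) : Prop := Nonempty (↥(coIdeal A) ≃o ↥(coIdeal B))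

/-- `(A) × (B) ≅ (A)`. -/
def ProdIdealIso (A B : Set W) : Prop :=
  Nonempty ((↥(coIdeal A) × ↥(coIdeal B)) ≃o ↥(coIdeal A))

/-- A compact open `A` is pseudo-indecomposable (PI). -/
def IsPISet (A : Set W) : Prop :=
  IsCompact A ∧ IsOpen A ∧ ∀ B : Set W, IsCompact B → IsOpen B → B ⊆ A →
    IdealIso B A ∨ IdealIso (A \ B) A

/-- `W` is primitive: every compact open set is a finite disjoint union of PI sets. -/
def PrimitiveSpace (W : Type*) [TopologicalSpace W] : Prop :=
  ∀ A : Set W, IsCompact A → IsOpen A →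
    ∃ (n : ℕ) (F : Fin n → Set W), (∀ i, IsPISet (F i)) ∧
      (Pairwise fun i j => Disjoint (F i) (F j)) ∧ A = ⋃ i, F i

/-- The setoid of PI compact opens up to isomorphism of their ideals. -/
def piIsoSetoid (W : Type*) [TopologicalSpace W] : Setoid {A : Set W // IsPISet A} where
  r A B := IdealIso A.1 B.1
  iseqv := ⟨fun _ => ⟨OrderIso.refl _⟩,
    fun h => h.elim fun e => ⟨e.symm⟩,
    fun h1 h2 => h1.elim fun e => h2.elim fun f => ⟨e.trans f⟩⟩

/-- The underlying set of the structure diagram `𝒮(W)`: isomorphism classes of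
PI compact open subsets of `W`. -/
def SDiagram (W : Type*) [TopologicalSpace W] : Type _ := Quotient (piIsoSetoid W)

/-- The relation on `𝒮(W)`: `[A] < [B]` iff `(A) × (B) ≅ (A)`. -/
def SDiagramLt {W : Type*} [TopologicalSpace W] (x y : SDiagram W) : Prop :=
  ∃ A B : {A : Set W // IsPISet A}, x = Quotient.mk (piIsoSetoid W) A ∧
    y = Quotient.mk (piIsoSetoid W) B ∧ ProdIdealIso A.1 B.1

/-- The blocks of the canonical partition `𝒳(W)`: points having a neighbourhood base
of compact open sets of class `p`. -/
def canonicalBlock {W : Type*} [TopologicalSpace W] (p : SDiagram W) : Set W :=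
  {w | ∀ U ∈ nhds w, ∃ A : {A : Set W // IsPISet A},
      Quotient.mk (piIsoSetoid W) A = p ∧ w ∈ A.1 ∧ A.1 ⊆ U}

/-- The setoid of points of `W` under the homeomorphism group. -/
def homeoSetoid (W : Type*) [TopologicalSpace W] : Setoid W where
  r w x := ∃ h : W ≃ₜ W, h w = x
  iseqv := ⟨fun w => ⟨Homeomorph.refl W, rfl⟩,
    fun h => h.elim fun e he => ⟨e.symm, by rw [← he, Homeomorph.symm_apply_apply]⟩,
    fun h1 h2 => h1.elim fun e he => h2.elim fun f hf =>
      ⟨e.trans f, by rw [Homeomorph.trans_apply, he, hf]⟩⟩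

end Primitive

theorem ptype_of_trim {N : Type u} {W : Type v} [TopologicalSpace W] {S : POSystem N}
    {U : N → Set W} {A : Set W} {p : N} (h : IsTrimAt S U A p) (q : N) :
    (A ∩ U q).Nonempty ↔ S.le p q := by
  have := h.2.2.1
  have h2 := Set.ext_iff.1 this q
  exact h2

theorem po_le_antisymm {N : Type u} (S : POSystem N) {a b : N} (h1 : S.le a b)
    (h2 : S.le b a) : a = b := by
  rcases h1 with h1 | h1
  · rcases h2 with h2 | h2
    · exact S.lt_antisymm h1 h2
    · exact h2.symm
  · exact h1

theorem Iw_isIdeal {N : Type u} {W : Type v} [TopologicalSpace W]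
    (S : POSystem N) (U : N → Set W) (hU : IsTrimPartition S U) (w : W) :
    POSystem.IsIdeal S (Iw S U w) := by
  obtain ⟨⟨hne, -, -⟩, hT1, -, hT3⟩ := hU
  refine ⟨?_, ?_, ?_⟩
  · obtain ⟨A, ⟨p, hp⟩, hw, -⟩ := hT1 w Set.univ Filter.univ_mem
    exact ⟨p, A, hp, hw⟩
  · rintro p ⟨A, hA, hw⟩ q hqp
    by_cases hpq : q = p
    · subst hpq
      exact ⟨A, hA, hw⟩
    obtain ⟨u, hu⟩ := hne q
    obtain ⟨B, hB, -⟩ := hT3 q u hu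
    have hAq : ∀ x, x ∈ A → x ∉ U q := fun x hx hxq =>
      hpq (po_le_antisymm S hqp ((ptype_of_trim hA q).1 ⟨x, hx, hxq⟩))
    refine ⟨A ∪ B, ⟨hA.1.union hB.1, hA.2.1.union hB.2.1, ?_, ?_⟩, Or.inl hw⟩
    · ext r
      constructor
      · rintro ⟨x, hx | hx, hxr⟩
        · exact POSystem.le_trans hqp ((ptype_of_trim hA r).1 ⟨x, hx, hxr⟩)
        · exact (ptype_of_trim hB r).1 ⟨x, hx, hxr⟩
      · intro hr
        obtain ⟨x, hx, hxr⟩ := (ptype_of_trim hB r).2 hr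
        exact ⟨x, Or.inr hx, hxr⟩
    · intro hq
      obtain ⟨x, hx, hux⟩ := hB.2.2.2 hq
      refine ⟨x, ⟨Or.inr hx.1, hx.2⟩, ?_⟩
      rintro y ⟨hy | hy, hyq⟩
      · exact absurd hyq (hAq y hy)
      · exact hux y ⟨hy, hyq⟩
  · rintro p ⟨A, hA, hwA⟩ q ⟨B, hB, hwB⟩
    obtain ⟨C, ⟨r, hC⟩, hwC, hCs⟩ :=
      hT1 w (A ∩ B) ((hA.2.1.inter hB.2.1).mem_nhds ⟨hwA, hwB⟩)
    obtain ⟨x, hx, hxr⟩ := (ptype_of_trim hC r).2 (Or.inr rfl)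
    exact ⟨r, ⟨C, hC, hwC⟩, (ptype_of_trim hA r).1 ⟨x, (hCs hx).1, hxr⟩,
      (ptype_of_trim hB r).1 ⟨x, (hCs hx).2, hxr⟩⟩

theorem mem_closure_iff_Iw {N : Type u} {W : Type v} [TopologicalSpace W]
    (S : POSystem N) (U : N → Set W) (hU : IsTrimPartition S U) (w : W) (K : Set N)
    (hK : POSystem.IsIdeal S K) :
    w ∈ closure (⋃ n ∈ K, U n) ↔ Iw S U w ⊆ K := by
  constructor
  · rintro h p ⟨A, hA, hw⟩
    obtain ⟨x, hxA, hx⟩ := mem_closure_iff.1 h A hA.2.1 hw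
    simp only [Set.mem_iUnion] at hx
    obtain ⟨n, hn, hxn⟩ := hx
    exact hK.2.1 n hn p ((ptype_of_trim hA n).1 ⟨x, hxA, hxn⟩)
  · intro h
    rw [mem_closure_iff_nhds]
    intro V hV
    obtain ⟨A, ⟨p, hA⟩, hw, hAV⟩ := hU.2.1 w V hV
    obtain ⟨x, hx, hxp⟩ := (ptype_of_trim hA p).2 (Or.inr rfl)
    exact ⟨x, hAV hx, Set.mem_biUnion (h ⟨A, hA, hw⟩) hxp⟩

/-- Hansoul's Lemma: for a trim `N`-partition of an ω-Stone space and an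
ideal `J` of `N`, `{w | I_w = J} = closure U_J \ ⋃_{K ⊊ J ideal} closure U_K`;
equivalently, `w ∈ closure U_K` iff `I_w ⊆ K` for every ideal `K`. -/
theorem ideal_generation {N : Type u} {W : Type v}
    [TopologicalSpace W] [SecondCountableTopology W] [LocallyCompactSpace W]
    [T2Space W] [TotallyDisconnectedSpace W]
    (S : POSystem N) (U : N → Set W) (hU : IsTrimPartition S U)
    (J : Set N) (hJ : POSystem.IsIdeal S J) :
    ({w : W | Iw S U w = J} =
      closure (⋃ n ∈ J, U n) \
        ⋃ K ∈ {K : Set N | POSystem.IsIdeal S K ∧ K ⊂ J}, closure (⋃ n ∈ K, U n)) ∧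
    ∀ (w : W) (K : Set N), POSystem.IsIdeal S K →
      (w ∈ closure (⋃ n ∈ K, U n) ↔ Iw S U w ⊆ K) := by
  refine ⟨?_, fun w K hK => mem_closure_iff_Iw S U hU w K hK⟩
  ext w
  simp only [Set.mem_setOf_eq, Set.mem_sdiff, Set.mem_iUnion, not_exists]
  constructor
  · intro h
    refine ⟨(mem_closure_iff_Iw S U hU w J hJ).2 h.subset, fun K hK hw => ?_⟩
    have := (mem_closure_iff_Iw S U hU w K hK.1).1 hw
    rw [h] at this
    exact hK.2.2 this
  · rintro ⟨h1, h2⟩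
    have h3 := (mem_closure_iff_Iw S U hU w J hJ).1 h1
    by_contra hne
    have hI := Iw_isIdeal S U hU w
    exact h2 _ ⟨hI, Set.ssubset_iff_subset_ne.2 ⟨h3, hne⟩⟩
      ((mem_closure_iff_Iw S U hU w _ hI).2 subset_rfl)
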